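/- Let n ≥ 2 and let v : ℝⁿ → ℝ be a convex C¹ function. Let μ be the measure on the unit sphere S^{n−1} ⊆ ℝⁿ with density e^{−v} with respect to the normalized rotation invariant measure on S^{n−1}. Then for every C¹ function g : ℝⁿ → ℝ with ∫_{S^{n−1}} g dμ = 0 one has ∫_{S^{n−1}} (n − 1 − ⟨∇v(x), x⟩) g(x)² dμ(x) ≤ ∫_{S^{n−1}} |∇_S g(x)|² dμ(x), where ∇_S g(x) = ∇g(x) − ⟨∇g(x), x⟩ x denotes the tangential (spherical) part of the gradient of g at x ∈ S^{n−1}. -/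

import Mathlib

open MeasureTheory Set
open scoped ENNReal RealInnerProductSpace

/-- The midpoint form of the Prékopa–Leindler inequality for a measure on a real vector space. -/
def PrekopaLeindler {E : Type*} [AddCommGroup E] [Module ℝ E] [MeasurableSpace E]
    (μ : Measure E) : Prop :=
  ∀ f g h : E → ℝ≥0∞, Measurable f → Measurable g → Measurable h →
    (∀ x y, f x * g y ≤ h ((2 : ℝ)⁻¹ • (x + y)) ^ 2) →
    (∫⁻ x, f x ∂μ) * (∫⁻ x, g x ∂μ) ≤ (∫⁻ x, h x ∂μ) ^ 2

/-- The Brunn–Minkowski inequality on the line for nonempty compact sets. -/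
theorem volume_add_volume_le_of_isCompact {K L C : Set ℝ} (hK : IsCompact K) (hL : IsCompact L)
    (hK0 : K.Nonempty) (hL0 : L.Nonempty) (h : ∀ x ∈ K, ∀ y ∈ L, x + y ∈ C) :
    volume K + volume L ≤ volume C := by
  obtain ⟨a, haK, ha⟩ := hK.exists_isGreatest hK0
  obtain ⟨b, hbL, hb⟩ := hL.exists_isLeast hL0
  have h1 : volume ((fun x => x + b) '' K) = volume K := by simp
  have h2 : volume ((fun x => a + x) '' L) = volume L := by simp
  rw [← h1, ← h2, ← measure_union₀]
  · apply measure_mono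
    rintro _ (⟨x, hx, rfl⟩ | ⟨x, hx, rfl⟩)
    · exact h x hx b hbL
    · exact h a haK x hx
  · exact (hL.image (by fun_prop)).measurableSet.nullMeasurableSet
  · refine measure_mono_null (t := {a + b}) ?_ (by simp)
    rintro _ ⟨⟨x, hx, rfl⟩, ⟨y, hy, hxy⟩⟩
    have := ha hx
    have := hb hy
    simp only [mem_singleton_iff] at *
    linarith

/-- The Brunn–Minkowski inequality on the line. -/
theorem volume_add_volume_le {A B C : Set ℝ} (hA : MeasurableSet A) (hB : MeasurableSet B)
    (hA0 : A.Nonempty) (hB0 : B.Nonempty) (h : ∀ x ∈ A, ∀ y ∈ B, x + y ∈ C) :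
    volume A + volume B ≤ volume C := by
  obtain ⟨a, ha⟩ := hA0
  obtain ⟨b, hb⟩ := hB0
  rw [hA.measure_eq_iSup_isCompact, hB.measure_eq_iSup_isCompact]
  simp only [iSup_and']
  refine ENNReal.biSup_add_biSup_le' ⟨∅, by simp⟩ ⟨∅, by simp⟩ ?_
  rintro K ⟨hKA, hK⟩ L ⟨hLB, hL⟩
  calc volume K + volume L ≤ volume (insert a K) + volume (insert b L) := by
        gcongr <;> exact subset_insert _ _
    _ ≤ volume C := volume_add_volume_le_of_isCompact (hK.insert a) (hL.insert b)
        (insert_nonempty _ _) (insert_nonempty _ _) fun x hx y hy =>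
          h x (insert_subset ha hKA hx) y (insert_subset hb hLB hy)

theorem ENNReal.mul_le_sq_of_add_le {a b c : ℝ≥0∞} (h : a + b ≤ 2 * c) : a * b ≤ c ^ 2 := by
  rcases eq_or_ne c ⊤ with rfl | hc
  · simp
  have hab : a + b ≠ ⊤ := ne_top_of_le_ne_top (by finiteness) h
  lift c to NNReal using hc
  lift a to NNReal using fun h => hab (by simp [h])
  lift b to NNReal using fun h => hab (by simp [h])
  norm_cast at h ⊢
  have h' : (a : ℝ) + b ≤ 2 * c := mod_cast h
  have : (a : ℝ) * b ≤ c ^ 2 := by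
    nlinarith [sq_nonneg ((a : ℝ) - b), a.2, b.2, c.2, mul_nonneg (add_nonneg a.2 b.2) c.2]
  exact_mod_cast this

/-- The layer cake formula for functions with values in `[0, 1]`. -/
theorem lintegral_eq_lintegral_meas_lt_of_le_one {f : ℝ → ℝ≥0∞} (hf : Measurable f)
    (hf1 : ∀ x, f x ≤ 1) :
    ∫⁻ x, f x = ∫⁻ t in Ioo (0 : ℝ) 1, volume {x | ENNReal.ofReal t < f x} := by
  have hfin (x) : f x ≠ ⊤ := ne_top_of_le_ne_top (by simp) (hf1 x)
  have h1 := lintegral_eq_lintegral_meas_lt volume (f := fun x => (f x).toReal)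
    (ae_of_all _ fun _ => ENNReal.toReal_nonneg) hf.ennreal_toReal.aemeasurable
  simp only [ENNReal.ofReal_toReal (hfin _)] at h1
  rw [h1, ← Ioo_union_Ici_eq_Ioi zero_lt_one, lintegral_union measurableSet_Ici
    (Set.disjoint_left.2 fun x hx hx' => hx.2.not_ge hx')]
  have h2 : ∫⁻ t in Ici (1 : ℝ), volume {x | t < (f x).toReal} = 0 := by
    rw [setLIntegral_congr_fun (g := fun _ => 0) measurableSet_Ici]
    · simp
    intro t ht
    have : {x | t < (f x).toReal} = ∅ := by
      ext x
      simpa using (ENNReal.toReal_mono (by simp) (hf1 x)).trans (by simpa using ht)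
    simp [this]
  rw [h2, add_zero]
  refine setLIntegral_congr_fun measurableSet_Ioo fun t ht => ?_
  simp only [ENNReal.ofReal_lt_iff_lt_toReal ht.1.le (hfin _)]

theorem lintegral_add_lintegral_le_of_iSup_eq_one {f g h : ℝ → ℝ≥0∞} (hf : Measurable f)
    (hg : Measurable g) (hh : Measurable h) (hf1 : ⨆ x, f x = 1) (hg1 : ⨆ x, g x = 1)
    (hfg : ∀ x y, f x * g y ≤ h ((2 : ℝ)⁻¹ • (x + y)) ^ 2) :
    (∫⁻ x, f x) + (∫⁻ x, g x) ≤ 2 * ∫⁻ x, h x := by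
  have hfle (x) : f x ≤ 1 := hf1 ▸ le_iSup f x
  have hgle (x) : g x ≤ 1 := hg1 ▸ le_iSup g x
  have hmono : ∫⁻ x, min (h x) 1 ≤ ∫⁻ x, h x := lintegral_mono fun x => min_le_left _ _
  refine le_trans ?_ (mul_le_mul_right hmono 2)
  rw [lintegral_eq_lintegral_meas_lt_of_le_one hf hfle,
    lintegral_eq_lintegral_meas_lt_of_le_one hg hgle,
    lintegral_eq_lintegral_meas_lt_of_le_one (hh.min measurable_const) (fun x => min_le_right _ _),
    ← lintegral_const_mul' _ _ (by simp), ← lintegral_add_left']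
  · refine setLIntegral_mono' measurableSet_Ioo fun t ht => ?_
    have ht1 : ENNReal.ofReal t < 1 := by simpa using ht.2
    have h2 : volume ((fun x : ℝ => 2 * x) '' {x | ENNReal.ofReal t < min (h x) 1}) =
        2 * volume {x | ENNReal.ofReal t < min (h x) 1} := by
      have := Measure.addHaar_smul (volume : Measure ℝ) 2 {x | ENNReal.ofReal t < min (h x) 1}
      simpa [← image_smul] using this
    rw [← h2]
    refine volume_add_volume_le (measurableSet_lt measurable_const hf)
      (measurableSet_lt measurable_const hg) ?_ ?_ ?_
    · exact lt_iSup_iff.1 (hf1 ▸ ht1)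
    · exact lt_iSup_iff.1 (hg1 ▸ ht1)
    · intro x hx y hy
      refine ⟨(2 : ℝ)⁻¹ • (x + y), ?_, by simp⟩
      simp only [mem_ofPred_eq, lt_min_iff] at *
      refine ⟨?_, ht1⟩
      have := (ENNReal.mul_lt_mul hx hy).trans_le (hfg x y)
      rw [← sq] at this
      exact lt_of_not_ge fun hle => this.not_ge (pow_le_pow_left' hle 2)
  · refine Antitone.measurable (fun s t hst => measure_mono fun x hx => ?_) |>.aemeasurable
    exact (ENNReal.ofReal_le_ofReal hst).trans_lt hx

theorem prekopaLeindler_real_of_bounded {f g h : ℝ → ℝ≥0∞} (hf : Measurable f)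
    (hg : Measurable g) (hh : Measurable h) (hfb : ⨆ x, f x ≠ ⊤) (hgb : ⨆ x, g x ≠ ⊤)
    (hfg : ∀ x y, f x * g y ≤ h ((2 : ℝ)⁻¹ • (x + y)) ^ 2) :
    (∫⁻ x, f x) * (∫⁻ x, g x) ≤ (∫⁻ x, h x) ^ 2 := by
  set F := ⨆ x, f x with hF
  set G := ⨆ x, g x with hG
  rcases eq_or_ne F 0 with hF0 | hF0
  · have : ∀ x, f x = 0 := fun x => le_zero_iff.1 (hF0 ▸ le_iSup f x)
    simp [this]
  rcases eq_or_ne G 0 with hG0 | hG0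
  · have : ∀ x, g x = 0 := fun x => le_zero_iff.1 (hG0 ▸ le_iSup g x)
    simp [this]
  obtain ⟨s, hs⟩ : ∃ s : ℝ≥0∞, s ^ 2 = F * G := by
    refine ⟨(F * G) ^ (1 / 2 : ℝ), ?_⟩
    rw [← ENNReal.rpow_natCast, ← ENNReal.rpow_mul]
    norm_num
  have hFG0 : F * G ≠ 0 := mul_ne_zero hF0 hG0
  have hFGt : F * G ≠ ⊤ := ENNReal.mul_ne_top hfb hgb
  have hs0 : s ≠ 0 := by rintro rfl; simp at hs; tauto
  have hst : s ≠ ⊤ := by rintro rfl; simp at hs; tauto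
  have hinv : F⁻¹ * G⁻¹ = s⁻¹ ^ 2 := by
    rw [← ENNReal.mul_inv (Or.inl hF0) (Or.inl hfb), ← hs, ENNReal.inv_pow]
  have key := ENNReal.mul_le_sq_of_add_le <|
    lintegral_add_lintegral_le_of_iSup_eq_one (f := fun x => F⁻¹ * f x)
    (g := fun x => G⁻¹ * g x) (h := fun x => s⁻¹ * h x) (hf.const_mul _) (hg.const_mul _)
    (hh.const_mul _) (by rw [← ENNReal.mul_iSup, ← hF, ENNReal.inv_mul_cancel hF0 hfb])
    (by rw [← ENNReal.mul_iSup, ← hG, ENNReal.inv_mul_cancel hG0 hgb]) (fun x y => by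
      rw [mul_mul_mul_comm, mul_pow, hinv]
      gcongr
      exact hfg x y)
  rw [lintegral_const_mul _ hf, lintegral_const_mul _ hg, lintegral_const_mul _ hh,
    mul_mul_mul_comm, mul_pow, hinv] at key
  rwa [ENNReal.mul_le_mul_iff_right (by simp [hst]) (by simp [hs0])] at key

/-- The Prékopa–Leindler inequality on the line. -/
theorem prekopaLeindler_real : PrekopaLeindler (volume : Measure ℝ) := by
  intro f g h hf hg hh hfg
  have htrunc {u : ℝ → ℝ≥0∞} (hu : Measurable u) :
      ∫⁻ x, u x = ⨆ N : ℕ, ∫⁻ x, min (u x) N := by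
    rw [← lintegral_iSup (fun N => hu.min measurable_const)]
    · refine lintegral_congr fun x => ?_
      rw [← inf_iSup_eq, ENNReal.iSup_natCast, inf_top_eq]
    · intro M N hMN x
      have : (M : ℝ≥0∞) ≤ N := mod_cast hMN
      dsimp only
      gcongr
  have hbdd (u : ℝ → ℝ≥0∞) (N : ℕ) : ⨆ x, min (u x) N ≠ ⊤ :=
    ne_top_of_le_ne_top (ENNReal.natCast_ne_top N) (iSup_le fun x => min_le_right _ _)
  rw [htrunc hf, htrunc hg]
  simp only [ENNReal.iSup_mul, ENNReal.mul_iSup]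
  refine iSup₂_le fun M N => prekopaLeindler_real_of_bounded (hf.min measurable_const)
    (hg.min measurable_const) hh (hbdd f _) (hbdd g _) fun x y => le_trans ?_ (hfg x y)
  gcongr <;> exact min_le_left _ _

theorem PrekopaLeindler.prod {E F : Type*} [AddCommGroup E] [Module ℝ E] [MeasurableSpace E]
    [AddCommGroup F] [Module ℝ F] [MeasurableSpace F] {μ : Measure E} {ν : Measure F}
    [SFinite ν] (hμ : PrekopaLeindler μ) (hν : PrekopaLeindler ν) :
    PrekopaLeindler (μ.prod ν) := by
  intro f g h hf hg hh hfg
  rw [lintegral_prod _ hf.aemeasurable, lintegral_prod _ hg.aemeasurable,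
    lintegral_prod _ hh.aemeasurable]
  refine hμ _ _ _ hf.lintegral_prod_right' hg.lintegral_prod_right' hh.lintegral_prod_right' ?_
  intro x x'
  exact hν _ _ _ (hf.comp measurable_prodMk_left) (hg.comp measurable_prodMk_left)
    (hh.comp measurable_prodMk_left) fun y y' => hfg (x, y) (x', y')

theorem PrekopaLeindler.of_measurePreserving {E F : Type*} [AddCommGroup E] [Module ℝ E]
    [MeasurableSpace E] [AddCommGroup F] [Module ℝ F] [MeasurableSpace F] {μ : Measure E}
    {ν : Measure F} (hμ : PrekopaLeindler μ) {e : E → F} (he : MeasurePreserving e μ ν)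
    (hlin : ∀ x y, e ((2 : ℝ)⁻¹ • (x + y)) = (2 : ℝ)⁻¹ • (e x + e y)) :
    PrekopaLeindler ν := by
  intro f g h hf hg hh hfg
  rw [← he.lintegral_comp hf, ← he.lintegral_comp hg, ← he.lintegral_comp hh]
  exact hμ _ _ _ (hf.comp he.measurable) (hg.comp he.measurable) (hh.comp he.measurable)
    fun x y => by simpa only [Function.comp_apply, hlin] using hfg (e x) (e y)

theorem prekopaLeindler_pi (n : ℕ) : PrekopaLeindler (volume : Measure (Fin n → ℝ)) := by
  induction n with
  | zero =>
    intro f g h _ _ _ hfg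
    rw [volume_pi, Measure.pi_of_empty _ 0]
    simp only [lintegral_dirac]
    convert hfg 0 0
  | succ n ih =>
    refine (prekopaLeindler_real.prod ih).of_measurePreserving
      ((volume_preserving_piFinSuccAbove (fun _ : Fin (n + 1) => ℝ) 0).symm _) fun x y => ?_
    ext i
    refine Fin.cases ?_ (fun j => ?_) i <;> simp [MeasurableEquiv.piFinSuccAbove, mul_add]

/-- The Prékopa–Leindler inequality on Euclidean space. -/
theorem prekopaLeindler_euclideanSpace (n : ℕ) :
    PrekopaLeindler (volume : Measure (EuclideanSpace ℝ (Fin n))) :=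
  (prekopaLeindler_pi n).of_measurePreserving (PiLp.volume_preserving_toLp (Fin n)) fun _ _ => rfl

section SphereMeasure
open Pointwise

variable {E : Type*} [NormedAddCommGroup E] [InnerProductSpace ℝ E] [FiniteDimensional ℝ E]
  [MeasurableSpace E] [BorelSpace E]

theorem charFun_eq_of_norm_eq {σ : Measure E} (hσ : ∀ R : E ≃ₗᵢ[ℝ] E, σ.map R = σ) {s t : E}
    (hst : ‖t‖ = ‖s‖) : charFun σ t = charFun σ s := by
  set R := (ℝ ∙ (t - s))ᗮ.reflection with hR
  have hRt : R t = s := Submodule.reflection_sub hst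
  rw [charFun_apply, charFun_apply]
  conv_rhs => rw [← hσ R]
  rw [integral_map R.continuous.aemeasurable (by fun_prop)]
  simp [← hRt]

/-- A finite measure on the unit sphere that is invariant under linear isometries is determined
by its mass. -/
theorem eq_smul_of_invariant_sphere {σ τ : Measure E} [IsProbabilityMeasure σ] [IsFiniteMeasure τ]
    (hσ : ∀ R : E ≃ₗᵢ[ℝ] E, σ.map R = σ) (hτ : ∀ R : E ≃ₗᵢ[ℝ] E, τ.map R = τ)
    (hσs : ∀ᵐ x ∂σ, ‖x‖ = 1) (hτs : ∀ᵐ x ∂τ, ‖x‖ = 1) : τ = τ univ • σ := by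
  have : IsFiniteMeasure (τ univ • σ) := Measure.smul_finite _ (measure_ne_top _ _)
  refine Measure.ext_of_charFun (funext fun t => ?_)
  have h1 : ∫ y, ∫ x, Complex.exp (⟪x, ‖t‖ • y⟫ * Complex.I) ∂σ ∂τ
      = τ.real univ * charFun σ t := by
    rw [integral_congr_ae (g := fun _ => charFun σ t)]
    · simp
    filter_upwards [hτs] with y hy
    exact charFun_eq_of_norm_eq hσ (by simp [norm_smul, hy])
  have h2 : ∫ x, ∫ y, Complex.exp (⟪y, ‖t‖ • x⟫ * Complex.I) ∂τ ∂σ = charFun τ t := by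
    rw [integral_congr_ae (g := fun _ => charFun τ t)]
    · simp
    filter_upwards [hσs] with y hy
    exact charFun_eq_of_norm_eq hτ (by simp [norm_smul, hy])
  have h3 : charFun (τ univ • σ) t = τ.real univ * charFun σ t := by
    simp [charFun_apply, integral_smul_measure, Measure.real]
  rw [h3, ← h1, ← h2, integral_integral_swap]
  · simp only [inner_smul_right, real_inner_comm]
  · refine Integrable.of_bound (C := 1) (by fun_prop) (ae_of_all _ fun x => ?_)
    simp [Function.uncurry, Complex.norm_exp]

theorem map_toSphere_invariant (R : E ≃ₗᵢ[ℝ] E) :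
    (((volume : Measure E).toSphere.map Subtype.val).map R) =
      (volume : Measure E).toSphere.map Subtype.val := by
  ext A hA
  have hR : Measurable R := R.continuous.measurable
  rw [Measure.map_apply hR hA, Measure.map_apply measurable_subtype_coe (hR hA),
    Measure.map_apply measurable_subtype_coe hA,
    Measure.toSphere_apply' _ (measurable_subtype_coe (hR hA)),
    Measure.toSphere_apply' _ (measurable_subtype_coe hA)]
  congr 1
  have hmem (A : Set E) (x : E) : x ∈ Ioo (0 : ℝ) 1 • (Subtype.val '' (Subtype.val ⁻¹' A :
      Set (Metric.sphere (0 : E) 1))) ↔ ∃ r ∈ Ioo (0 : ℝ) 1, ∃ y ∈ A, ‖y‖ = 1 ∧ r • y = x := by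
    simp only [Set.mem_smul, Subtype.image_preimage_coe]
    simp [and_assoc, and_left_comm]
  conv_rhs => rw [← R.measurePreserving.measure_preimage_equiv (f := R.toMeasurableEquiv)]
  congr 1
  ext x
  rw [mem_preimage, hmem, hmem]
  constructor
  · rintro ⟨r, hr, y, hy, hy1, rfl⟩
    exact ⟨r, hr, R y, hy, by simpa using hy1, by simp⟩
  · rintro ⟨r, hr, y, hy, hy1, hyx⟩
    refine ⟨r, hr, R.symm y, by simpa using hy, by simpa using hy1, ?_⟩
    apply R.injective
    simpa using hyx

/-- Integration in polar coordinates. -/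
theorem lintegral_eq_lintegral_sphere_lintegral_Ioi {f : E → ℝ≥0∞} (hf : Measurable f)
    [Nontrivial E] :
    ∫⁻ x, f x = ∫⁻ θ, (∫⁻ r in Ioi (0 : ℝ), ENNReal.ofReal (r ^ (Module.finrank ℝ E - 1)) *
      f (r • θ)) ∂((volume : Measure E).toSphere.map Subtype.val) := by
  have hmeas : Measurable fun p : E × ℝ =>
      ENNReal.ofReal (p.2 ^ (Module.finrank ℝ E - 1)) * f (p.2 • p.1) := by fun_prop
  rw [lintegral_map hmeas.lintegral_prod_right' measurable_subtype_coe]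
  calc ∫⁻ x, f x = ∫⁻ x : ({(0)}ᶜ : Set E), f x ∂(volume.comap Subtype.val) := by
        rw [lintegral_subtype_comap (measurableSet_singleton _).compl f, restrict_compl_singleton]
    _ = ∫⁻ p, f (p.2.1 • p.1.1) ∂(volume : Measure E).toSphere.prod
          (.volumeIoiPow (Module.finrank ℝ E - 1)) := by
        rw [← (volume : Measure E).measurePreserving_homeomorphUnitSphereProd.lintegral_comp
          (by fun_prop)]
        refine lintegral_congr fun x => ?_
        have hx : ‖(x : E)‖ ≠ 0 := norm_ne_zero_iff.2 x.2
        simp [smul_smul, hx]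
    _ = _ := by
        rw [lintegral_prod _ (by fun_prop)]
        refine lintegral_congr fun θ => ?_
        rw [Measure.volumeIoiPow, lintegral_withDensity_eq_lintegral_mul _ (by fun_prop)
          (by fun_prop)]
        exact lintegral_subtype_comap measurableSet_Ioi fun r : ℝ =>
          ENNReal.ofReal (r ^ (Module.finrank ℝ E - 1)) * f (r • (θ : E))

/-- Integration in polar coordinates with respect to a rotation invariant probability measure on
the unit sphere. -/
theorem exists_lintegral_eq_mul_lintegral_sphere [Nontrivial E] {σ : Measure E}
    [IsProbabilityMeasure σ] (hσ : ∀ R : E ≃ₗᵢ[ℝ] E, σ.map R = σ) (hσs : ∀ᵐ x ∂σ, ‖x‖ = 1) :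
    ∃ c : ℝ≥0∞, c ≠ 0 ∧ c ≠ ⊤ ∧ ∀ f : E → ℝ≥0∞, Measurable f →
      ∫⁻ x, f x = c * ∫⁻ θ, (∫⁻ r in Ioi (0 : ℝ),
        ENNReal.ofReal (r ^ (Module.finrank ℝ E - 1)) * f (r • θ)) ∂σ := by
  set τ := (volume : Measure E).toSphere.map Subtype.val with hτ
  have hτs : ∀ᵐ x ∂τ, ‖x‖ = 1 := by
    rw [hτ, ae_map_iff (by fun_prop) (measurableSet_eq_fun (by fun_prop) (by fun_prop))]
    exact ae_of_all _ fun x => by simp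
  have hfin : IsFiniteMeasure τ := Measure.isFiniteMeasure_map _ _
  have heq : τ = τ univ • σ := eq_smul_of_invariant_sphere hσ map_toSphere_invariant hσs hτs
  refine ⟨τ univ, ?_, measure_ne_top _ _, fun f hf => ?_⟩
  · rw [hτ, Measure.map_apply measurable_subtype_coe .univ, preimage_univ, Ne,
      Measure.measure_univ_eq_zero]
    exact Measure.toSphere_ne_zero _
  · rw [lintegral_eq_lintegral_sphere_lintegral_Ioi hf, ← hτ]
    conv_lhs => rw [heq]
    rw [lintegral_smul_measure, smul_eq_mul]

end SphereMeasure

section SupportFunction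
open Filter Topology

theorem eventually_mul_le (A : ℝ) {b : ℝ} (hb : 0 < b) : ∀ᶠ t in 𝓝[>] (0 : ℝ), A * t ≤ b := by
  have : Tendsto (fun t => A * t) (𝓝[>] (0 : ℝ)) (𝓝 0) := by
    have h : Continuous fun t : ℝ => A * t := by fun_prop
    simpa using (h.tendsto 0).mono_left nhdsWithin_le_nhds
  exact (this.eventually_lt_const hb).mono fun _ => le_of_lt

variable {E : Type*} [NormedAddCommGroup E] [InnerProductSpace ℝ E] [FiniteDimensional ℝ E]

theorem exists_abs_le_of_norm_eq_one {f : E → ℝ} (hf : Continuous f) :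
    ∃ M, 0 ≤ M ∧ ∀ x, ‖x‖ = 1 → |f x| ≤ M := by
  obtain ⟨M, hM⟩ := (isCompact_sphere (0 : E) 1).exists_bound_of_continuousOn hf.continuousOn
  exact ⟨max M 0, le_max_right _ _, fun x hx => (hM x (by simpa using hx)).trans (le_max_left _ _)⟩

theorem continuous_gradient {g : E → ℝ} (hg : ContDiff ℝ 1 g) : Continuous (gradient g) :=
  (InnerProductSpace.toDual ℝ E).symm.continuous.comp (hg.continuous_fderiv one_ne_zero)

/-- The tangential part at `x` of the gradient of `g`, for `x` on the unit sphere. -/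
noncomputable def tangentialGradient (g : E → ℝ) (x : E) : E :=
  gradient g x - ⟪gradient g x, x⟫ • x

theorem continuous_tangentialGradient {g : E → ℝ} (hg : ContDiff ℝ 1 g) :
    Continuous (tangentialGradient g) := by
  have := continuous_gradient hg
  unfold tangentialGradient
  fun_prop

theorem inner_gradient_sub_eq {g : E → ℝ} {x y : E} (hx : ‖x‖ = 1) (hy : ‖y‖ = 1) :
    ⟪gradient g x, x - y⟫ =
      ⟪tangentialGradient g x, x - y⟫ + ⟪gradient g x, x⟫ * (‖x - y‖ ^ 2 / 2) := by
  have h : ⟪x, x - y⟫ = ‖x - y‖ ^ 2 / 2 := by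
    rw [norm_sub_sq_real, inner_sub_right, real_inner_self_eq_norm_sq, hx, hy]
    ring
  rw [tangentialGradient, inner_sub_left, real_inner_smul_left, h]
  ring

theorem exists_sub_le_norm_tangentialGradient {g : E → ℝ} (hg : ContDiff ℝ 1 g) {ε : ℝ}
    (hε : 0 < ε) : ∃ C, 0 ≤ C ∧ ∀ x y, ‖x‖ = 1 → ‖y‖ = 1 →
      g x - g y ≤ (‖tangentialGradient g x‖ + ε) * ‖x - y‖ + C * ‖x - y‖ ^ 2 := by
  obtain ⟨B, hB0, hB⟩ := exists_abs_le_of_norm_eq_one hg.continuous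
  have hgc := continuous_gradient hg
  obtain ⟨M, hM0, hM⟩ := exists_abs_le_of_norm_eq_one
    (f := fun x => ⟪gradient g x, x⟫) (by fun_prop)
  have huc := (isCompact_closedBall (0 : E) 1).uniformContinuousOn_of_continuous
    (hg.continuous_fderiv one_ne_zero).continuousOn
  obtain ⟨d, hd0, hd⟩ := Metric.uniformContinuousOn_iff.1 huc ε hε
  refine ⟨M + 2 * B / d ^ 2, by positivity, fun x y hx hy => ?_⟩
  have hN := norm_nonneg (tangentialGradient g x)
  have hxy := norm_nonneg (x - y)
  rcases lt_or_ge ‖x - y‖ d with hlt | hge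
  · have hmv := (((convex_closedBall (0 : E) 1).inter
      (convex_ball x d)).norm_image_sub_le_of_norm_fderiv_le' (f := g) (φ := fderiv ℝ g x)
      (C := ε) (x := x) (y := y) (fun z _ => hg.differentiable one_ne_zero z)
      (fun z hz => by
        rw [← dist_eq_norm]
        exact (hd z hz.1 x (by simp [hx]) hz.2).le) ⟨by simp [hx], by simpa using hd0⟩
      ⟨by simp [hy], by simpa [dist_eq_norm, norm_sub_rev] using hlt⟩)
    have hfd : fderiv ℝ g x (y - x) = - ⟪gradient g x, x - y⟫ := by
      rw [← inner_neg_right, neg_sub, gradient, InnerProductSpace.toDual_symm_apply]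
    rw [hfd, inner_gradient_sub_eq hx hy, Real.norm_eq_abs, norm_sub_rev y x] at hmv
    have h1 := (abs_le.1 hmv).1
    have h2 := real_inner_le_norm (tangentialGradient g x) (x - y)
    have h3 := (abs_le.1 (hM x hx)).2
    have h4 : ⟪gradient g x, x⟫ * (‖x - y‖ ^ 2 / 2) ≤ M * (‖x - y‖ ^ 2 / 2) := by gcongr
    have h5 : 0 ≤ M * ‖x - y‖ ^ 2 := by positivity
    have h6 : 0 ≤ 2 * B / d ^ 2 * ‖x - y‖ ^ 2 := by positivity
    linarith
  · have h1 : g x - g y ≤ 2 * B := by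
      have := (abs_le.1 (hB x hx)).2
      have := (abs_le.1 (hB y hy)).1
      linarith
    have h2 : 2 * B ≤ 2 * B / d ^ 2 * ‖x - y‖ ^ 2 := by
      rw [div_mul_eq_mul_div, le_div_iff₀ (by positivity)]
      gcongr
    have h3 : 0 ≤ M * ‖x - y‖ ^ 2 := by positivity
    have h4 : 0 ≤ (‖tangentialGradient g x‖ + ε) * ‖x - y‖ := by positivity
    linarith

/-- The radial function, up to an error of order `t ^ 2`, of the convex set with support function
`1 + t * g`. -/
noncomputable def perturbedRadius (g : E → ℝ) (δ t : ℝ) (x : E) : ℝ :=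
  1 + t * g x - t ^ 2 * ((‖tangentialGradient g x‖ ^ 2 + δ) / 2)

theorem eventually_perturbedRadius_mul_inner_le {g : E → ℝ} (hg : ContDiff ℝ 1 g) {δ : ℝ}
    (hδ : 0 < δ) : ∀ᶠ t in 𝓝[>] (0 : ℝ), ∀ x y, ‖x‖ = 1 → ‖y‖ = 1 →
      perturbedRadius g δ t x * ⟪x, y⟫ ≤ 1 + t * g y := by
  obtain ⟨B, hB0, hB⟩ := exists_abs_le_of_norm_eq_one hg.continuous
  have hT := continuous_tangentialGradient hg
  obtain ⟨M, hM0, hM⟩ := exists_abs_le_of_norm_eq_one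
    (f := fun x => ‖tangentialGradient g x‖) (by fun_prop)
  obtain ⟨ε, hε0, hε1, hε⟩ : ∃ ε : ℝ, 0 < ε ∧ ε ≤ 1 ∧ ε * (2 * M + 1) ≤ δ / 2 := by
    refine ⟨min 1 (δ / (2 * (2 * M + 1))), by positivity, min_le_left _ _, ?_⟩
    calc min 1 (δ / (2 * (2 * M + 1))) * (2 * M + 1)
        ≤ δ / (2 * (2 * M + 1)) * (2 * M + 1) := by gcongr; exact min_le_right _ _
      _ = δ / 2 := by field_simp
  obtain ⟨C, hC0, hC⟩ := exists_sub_le_norm_tangentialGradient hg hε0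
  set A := B + (M ^ 2 + δ) / 2 + 2 * C with hA
  have hA0 : 0 ≤ A := by positivity
  filter_upwards [self_mem_nhdsWithin, eventually_mul_le 1 one_pos,
    eventually_mul_le A (show (0 : ℝ) < 1 / 2 by norm_num),
    eventually_mul_le (A * (M ^ 2 + δ)) (half_pos hδ)] with t ht0 ht1 htA htA' x y hx hy
  replace ht0 : 0 < t := ht0
  set N := ‖tangentialGradient g x‖ with hN
  set d := ‖x - y‖ with hd
  have hN0 : 0 ≤ N := norm_nonneg _
  have hd0 : 0 ≤ d := norm_nonneg _
  have hNM : N ≤ M := (le_abs_self _).trans (hM x hx)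
  have hinner : ⟪x, y⟫ = 1 - d ^ 2 / 2 := by
    rw [hd, norm_sub_sq_real, hx, hy]
    ring
  set κ := 1 - A * t with hκ
  have hκ0 : 0 < κ := by linarith
  have hNM2 : N ^ 2 ≤ M ^ 2 := by gcongr
  have hR : κ + 2 * C * t ≤ perturbedRadius g δ t x := by
    have h1 : -B ≤ g x := (abs_le.1 (hB x hx)).1
    have h2 : t * (-B) ≤ t * g x := by gcongr
    have h3 : t ^ 2 * ((N ^ 2 + δ) / 2) ≤ t * ((M ^ 2 + δ) / 2) := by
      have : t ^ 2 ≤ t := by nlinarith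
      gcongr
    rw [perturbedRadius, ← hN, hκ, hA]
    linarith
  have hsq : (N + ε) ^ 2 ≤ κ * (N ^ 2 + δ) := by
    have h1 : A * t * (N ^ 2 + δ) ≤ A * t * (M ^ 2 + δ) := by gcongr
    have h2 : 2 * ε * N ≤ 2 * ε * M := by gcongr
    have h3 : ε ^ 2 ≤ ε := by nlinarith
    rw [hκ]
    linarith
  have hyoung : 2 * t * (N + ε) * d ≤ t ^ 2 * (N ^ 2 + δ) + κ * d ^ 2 := by
    have h1 : t ^ 2 * (N + ε) ^ 2 ≤ t ^ 2 * (κ * (N ^ 2 + δ)) := by gcongr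
    refine le_of_mul_le_mul_left ?_ hκ0
    linarith [sq_nonneg (t * (N + ε) - κ * d)]
  have hgxy : t * (g x - g y) ≤ t * ((N + ε) * d + C * d ^ 2) := by
    gcongr
    exact hC x y hx hy
  have hRd : (κ + 2 * C * t) * (d ^ 2 / 2) ≤ perturbedRadius g δ t x * (d ^ 2 / 2) := by gcongr
  have hRdef : perturbedRadius g δ t x = 1 + t * g x - t ^ 2 * ((N ^ 2 + δ) / 2) := rfl
  rw [hinner]
  linarith

end SupportFunction
section RadialExpansion
open Filter Topology

theorem abs_integral_sub_le_of_deriv {f f' : ℝ → ℝ} (hf : ∀ r, HasDerivAt f (f' r) r) {ε R : ℝ}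
    (h : ∀ r ∈ uIcc 1 R, |f' r - f' 1| ≤ ε) :
    |(∫ r in (1 : ℝ)..R, f r) - (f 1 * (R - 1) + f' 1 * ((R - 1) ^ 2 / 2))| ≤ ε * (R - 1) ^ 2 := by
  have hfc : Continuous f := continuous_iff_continuousAt.2 fun r => (hf r).continuousAt
  have hlin : ∫ r in (1 : ℝ)..R, (f 1 + f' 1 * (r - 1)) =
      f 1 * (R - 1) + f' 1 * ((R - 1) ^ 2 / 2) := by
    rw [intervalIntegral.integral_add (by simp) (Continuous.intervalIntegrable (by fun_prop) _ _)]
    simp [integral_id]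
    ring
  rw [← hlin, ← intervalIntegral.integral_sub (hfc.intervalIntegrable _ _)
    (Continuous.intervalIntegrable (by fun_prop) _ _)]
  have hε : 0 ≤ ε := (abs_nonneg _).trans (h 1 left_mem_uIcc)
  have hbound : ∀ r ∈ uIoc 1 R, ‖f r - (f 1 + f' 1 * (r - 1))‖ ≤ ε * |R - 1| := by
    intro r hr
    have hr' : r ∈ uIcc 1 R := uIoc_subset_uIcc hr
    have hmv := (convex_uIcc 1 R).norm_image_sub_le_of_norm_hasDerivWithin_le
      (f := fun r => f r - f' 1 * r) (f' := fun r => f' r - f' 1) (C := ε)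
      (fun s _ => ((hf s).sub ((hasDerivAt_id s).const_mul (f' 1) |>.congr_deriv
        (mul_one _))).hasDerivWithinAt)
      (fun s hs => h s hs) left_mem_uIcc hr'
    have hle : |r - 1| ≤ |R - 1| := by
      simpa using abs_sub_left_of_mem_uIcc hr'
    calc ‖f r - (f 1 + f' 1 * (r - 1))‖ = ‖f r - f' 1 * r - (f 1 - f' 1 * 1)‖ := by
          congr 1; ring
      _ ≤ ε * ‖r - 1‖ := hmv
      _ ≤ ε * |R - 1| := by rw [Real.norm_eq_abs]; gcongr
  have := intervalIntegral.norm_integral_le_of_norm_le_const hbound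
  rwa [Real.norm_eq_abs, mul_assoc, ← sq, sq_abs] at this

variable {E : Type*} [NormedAddCommGroup E] [InnerProductSpace ℝ E]

/-- The density of `exp (-v)` in polar coordinates in dimension `m + 1`. -/
noncomputable def radialDensity (m : ℕ) (v : E → ℝ) (x : E) (r : ℝ) : ℝ :=
  r ^ m * Real.exp (-v (r • x))

theorem continuous_radialDensity (m : ℕ) {v : E → ℝ} (hv : Continuous v) :
    Continuous fun p : E × ℝ => radialDensity m v p.1 p.2 := by
  unfold radialDensity
  fun_prop

theorem radialDensity_nonneg (m : ℕ) (v : E → ℝ) (x : E) {r : ℝ} (hr : 0 ≤ r) :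
    0 ≤ radialDensity m v x r := by
  unfold radialDensity
  positivity

variable [FiniteDimensional ℝ E]

/-- The derivative of `radialDensity m v x`. -/
noncomputable def radialDensityDeriv (m : ℕ) (v : E → ℝ) (x : E) (r : ℝ) : ℝ :=
  (m * r ^ (m - 1) - r ^ m * ⟪gradient v (r • x), x⟫) * Real.exp (-v (r • x))

theorem hasDerivAt_radialDensity (m : ℕ) {v : E → ℝ} (hv : ContDiff ℝ 1 v) (x : E) (r : ℝ) :
    HasDerivAt (radialDensity m v x) (radialDensityDeriv m v x r) r := by
  have h1 : HasDerivAt (fun r : ℝ => v (r • x)) ⟪gradient v (r • x), x⟫ r := by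
    have hd := (hv.differentiable one_ne_zero (r • x)).hasFDerivAt.comp_hasDerivAt r
      ((hasDerivAt_id r).smul_const x)
    exact hd.congr_deriv (by simp [gradient, InnerProductSpace.toDual_symm_apply])
  refine ((hasDerivAt_pow m r).mul h1.neg.exp).congr_deriv ?_
  simp only [radialDensityDeriv, Pi.neg_apply]
  ring

theorem continuous_radialDensityDeriv (m : ℕ) {v : E → ℝ} (hv : ContDiff ℝ 1 v) :
    Continuous fun p : E × ℝ => radialDensityDeriv m v p.1 p.2 := by
  have h1 := continuous_gradient hv
  have h2 := hv.continuous
  unfold radialDensityDeriv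
  fun_prop

theorem exists_abs_integral_radialDensity_sub_le (m : ℕ) {v : E → ℝ} (hv : ContDiff ℝ 1 v) {ε : ℝ}
    (hε : 0 < ε) : ∃ η > 0, ∀ x : E, ‖x‖ = 1 → ∀ R, |R - 1| ≤ η →
      |(∫ r in (1 : ℝ)..R, radialDensity m v x r) - (Real.exp (-v x) * (R - 1) +
        (m - ⟪gradient v x, x⟫) * Real.exp (-v x) * ((R - 1) ^ 2 / 2))| ≤ ε * (R - 1) ^ 2 := by
  have huc := ((isCompact_sphere (0 : E) 1).prod
    (isCompact_Icc (a := (0 : ℝ)) (b := 2))).uniformContinuousOn_of_continuous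
    (continuous_radialDensityDeriv m hv).continuousOn
  obtain ⟨d, hd0, hd⟩ := Metric.uniformContinuousOn_iff.1 huc ε hε
  refine ⟨min 1 (d / 2), by positivity, fun x hx R hR => ?_⟩
  have key := abs_integral_sub_le_of_deriv (R := R) (ε := ε) (hasDerivAt_radialDensity m hv x)
    fun r hr => by
      have hle : |r - 1| ≤ min 1 (d / 2) :=
        le_trans (by simpa using abs_sub_left_of_mem_uIcc hr) hR
      have h1 := abs_le.1 (hle.trans (min_le_left _ _))
      refine (hd (x, r) ⟨by simpa using hx, ?_, ?_⟩ (x, 1) ⟨by simpa using hx, ?_, ?_⟩ ?_).le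
      · linarith
      · linarith
      · norm_num
      · norm_num
      · rw [dist_prod_same_left, Real.dist_eq]
        exact (hle.trans (min_le_right _ _)).trans_lt (by linarith)
  simpa [radialDensity, radialDensityDeriv] using key

theorem eventually_le_integral_radialDensity (m : ℕ) {v g p : E → ℝ} (hv : ContDiff ℝ 1 v)
    (hg : Continuous g) (hp : Continuous p) {ε : ℝ} (hε : 0 < ε) :
    ∀ᶠ t in 𝓝[>] (0 : ℝ), ∀ x : E, ‖x‖ = 1 → 0 ≤ 1 + t * g x - t ^ 2 * p x ∧
      (∫ r in (0 : ℝ)..1, radialDensity m v x r) + t * (Real.exp (-v x) * g x) +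
        t ^ 2 * (Real.exp (-v x) * ((m - ⟪gradient v x, x⟫) * g x ^ 2 / 2 - p x) - ε) ≤
      ∫ r in (0 : ℝ)..(1 + t * g x - t ^ 2 * p x), radialDensity m v x r := by
  have hgrad := continuous_gradient hv
  have hvc := hv.continuous
  obtain ⟨B, hB0, hB⟩ := exists_abs_le_of_norm_eq_one hg
  obtain ⟨P, hP0, hP⟩ := exists_abs_le_of_norm_eq_one hp
  obtain ⟨D, hD0, hD⟩ := exists_abs_le_of_norm_eq_one
    (f := fun x => (m - ⟪gradient v x, x⟫) * Real.exp (-v x)) (by fun_prop)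
  set A := B + P with hA
  have hA0 : 0 ≤ A := by positivity
  obtain ⟨η, hη0, hη⟩ := exists_abs_integral_radialDensity_sub_le m hv
    (show 0 < ε / (2 * (A ^ 2 + 1)) by positivity)
  filter_upwards [self_mem_nhdsWithin, eventually_mul_le 1 one_pos, eventually_mul_le A one_pos,
    eventually_mul_le A hη0, eventually_mul_le (D * ((2 * B + P) * P / 2)) (half_pos hε)]
    with t ht0 ht1 htA htη htD x hx
  replace ht0 : 0 < t := ht0
  have hgx := hB x hx
  have hpx := hP x hx
  have hDx := hD x hx
  set R := 1 + t * g x - t ^ 2 * p x with hR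
  have ht2 : t ^ 2 ≤ t := by nlinarith
  have hR1 : |R - 1| ≤ A * t := by
    calc |R - 1| = |t * g x - t ^ 2 * p x| := by rw [hR]; congr 1; ring
      _ ≤ |t * g x| + |t ^ 2 * p x| := abs_sub _ _
      _ = t * |g x| + t ^ 2 * |p x| := by
          rw [abs_mul, abs_mul, abs_of_pos ht0, abs_of_pos (by positivity : 0 < t ^ 2)]
      _ ≤ t * B + t * P := by gcongr
      _ = A * t := by rw [hA]; ring
  refine ⟨by linarith [(abs_le.1 (hR1.trans htA)).1], ?_⟩
  have key := (abs_le.1 (hη x hx R (hR1.trans htη))).1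
  have hcont : Continuous (radialDensity m v x) :=
    (continuous_radialDensity m hvc).comp (by fun_prop : Continuous fun r : ℝ => (x, r))
  rw [← intervalIntegral.integral_add_adjacent_intervals (hcont.intervalIntegrable 0 1)
    (hcont.intervalIntegrable 1 R)]
  have herr1 : ε / (2 * (A ^ 2 + 1)) * (R - 1) ^ 2 ≤ t ^ 2 * (ε / 2) := by
    have h1 : (R - 1) ^ 2 ≤ (A * t) ^ 2 := sq_le_sq' (by linarith [(abs_le.1 hR1).1])
      (abs_le.1 hR1).2
    calc ε / (2 * (A ^ 2 + 1)) * (R - 1) ^ 2 ≤ ε / (2 * (A ^ 2 + 1)) * (A * t) ^ 2 := by gcongr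
      _ = t ^ 2 * (ε / 2) * (A ^ 2 / (A ^ 2 + 1)) := by field_simp
      _ ≤ t ^ 2 * (ε / 2) * 1 := by
          gcongr
          exact div_le_one_of_le₀ (by linarith) (by positivity)
      _ = _ := mul_one _
  have herr2 : |(m - ⟪gradient v x, x⟫) * Real.exp (-v x) * (((R - 1) ^ 2 - t ^ 2 * g x ^ 2) / 2)|
      ≤ t ^ 2 * (ε / 2) := by
    have h1 : |((R - 1) ^ 2 - t ^ 2 * g x ^ 2) / 2| ≤ t ^ 3 * ((2 * B + P) * P / 2) := by
      have h2 : ((R - 1) ^ 2 - t ^ 2 * g x ^ 2) / 2 =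
          t ^ 3 * ((t * p x - 2 * g x) * p x / 2) := by rw [hR]; ring
      have h3 : |t * p x - 2 * g x| ≤ 2 * B + P := by
        calc |t * p x - 2 * g x| ≤ |t * p x| + |2 * g x| := abs_sub _ _
          _ = t * |p x| + 2 * |g x| := by rw [abs_mul, abs_mul, abs_of_pos ht0, abs_two]
          _ ≤ 1 * P + 2 * B := by gcongr; linarith
          _ = 2 * B + P := by ring
      rw [h2, abs_mul, abs_div, abs_mul, abs_two, abs_of_pos (by positivity : 0 < t ^ 3)]
      gcongr
    rw [abs_mul]
    calc _ ≤ D * (t ^ 3 * ((2 * B + P) * P / 2)) := by gcongr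
      _ = t ^ 2 * (D * ((2 * B + P) * P / 2) * t) := by ring
      _ ≤ _ := by gcongr
  have h4 := (abs_le.1 herr2).1
  have h5 : R - 1 = t * g x - t ^ 2 * p x := by rw [hR]; ring
  generalize (∫ r in (1 : ℝ)..R, radialDensity m v x r) = J at *
  have h6 : Real.exp (-v x) * (R - 1) = Real.exp (-v x) * (t * g x - t ^ 2 * p x) := by rw [h5]
  linarith

end RadialExpansion

section WeightedPoincare
open Filter Topology

theorem ofReal_integral_le_lintegral_ofReal {α : Type*} [MeasurableSpace α] {μ : Measure α}
    {f : α → ℝ} (hf : Integrable f μ) :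
    ENNReal.ofReal (∫ x, f x ∂μ) ≤ ∫⁻ x, ENNReal.ofReal (f x) ∂μ := by
  calc ENNReal.ofReal (∫ x, f x ∂μ) ≤ ENNReal.ofReal (∫ x, max (f x) 0 ∂μ) :=
        ENNReal.ofReal_le_ofReal (integral_mono hf hf.pos_part fun x => le_max_left _ _)
    _ = ∫⁻ x, ENNReal.ofReal (max (f x) 0) ∂μ :=
        ofReal_integral_eq_lintegral_ofReal hf.pos_part (ae_of_all _ fun x => le_max_right _ _)
    _ = ∫⁻ x, ENNReal.ofReal (f x) ∂μ := by simp [ENNReal.ofReal_max]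

variable {E : Type*} [NormedAddCommGroup E] [InnerProductSpace ℝ E]

theorem setLIntegral_radialDensity (m : ℕ) {v : E → ℝ} (hv : Continuous v) (x : E) {R : ℝ}
    (hR : 0 ≤ R) : ∫⁻ r in Ioc 0 R, ENNReal.ofReal (radialDensity m v x r) =
      ENNReal.ofReal (∫ r in (0 : ℝ)..R, radialDensity m v x r) := by
  have hcont : Continuous (radialDensity m v x) :=
    (continuous_radialDensity m hv).comp (by fun_prop : Continuous fun r : ℝ => (x, r))
  rw [intervalIntegral.integral_of_le hR, ofReal_integral_eq_lintegral_ofReal]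
  · exact (hcont.intervalIntegrable 0 R).1
  · filter_upwards [ae_restrict_mem measurableSet_Ioc] with r hr
    exact radialDensity_nonneg m v x hr.1.le

theorem ofReal_pow_mul_indicator_of_mem (m : ℕ) (v : E → ℝ) {K : Set E} {x : E} {r : ℝ}
    (hr : 0 < r) (hK : r • x ∈ K) :
    ENNReal.ofReal (r ^ m) * K.indicator (fun y => ENNReal.ofReal (Real.exp (-v y))) (r • x) =
      ENNReal.ofReal (radialDensity m v x r) := by
  rw [indicator_of_mem hK, radialDensity, ENNReal.ofReal_mul (by positivity)]

theorem ofReal_integral_radialDensity_le (m : ℕ) {v : E → ℝ} (hv : Continuous v) {K : Set E}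
    {x : E} {R : ℝ} (hR : 0 ≤ R) (hK : ∀ r ∈ Ioc 0 R, r • x ∈ K) :
    ENNReal.ofReal (∫ r in (0 : ℝ)..R, radialDensity m v x r) ≤
      ∫⁻ r in Ioi (0 : ℝ), ENNReal.ofReal (r ^ m) *
        K.indicator (fun y => ENNReal.ofReal (Real.exp (-v y))) (r • x) := by
  rw [← setLIntegral_radialDensity m hv x hR]
  refine le_trans (le_of_eq ?_) (lintegral_mono_set (Ioc_subset_Ioi_self : Ioc 0 R ⊆ Ioi 0))
  exact setLIntegral_congr_fun measurableSet_Ioc fun r hr =>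
    (ofReal_pow_mul_indicator_of_mem m v hr.1 (hK r hr)).symm

theorem le_ofReal_integral_radialDensity (m : ℕ) {v : E → ℝ} (hv : Continuous v) {K : Set E}
    {x : E} (hK : ∀ r : ℝ, 0 < r → r • x ∈ K → r ≤ 1) :
    ∫⁻ r in Ioi (0 : ℝ), ENNReal.ofReal (r ^ m) *
        K.indicator (fun y => ENNReal.ofReal (Real.exp (-v y))) (r • x) ≤
      ENNReal.ofReal (∫ r in (0 : ℝ)..1, radialDensity m v x r) := by
  have hset : Ioc (0 : ℝ) 1 = Iic 1 ∩ Ioi 0 := by rw [inter_comm, Ioi_inter_Iic]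
  rw [← setLIntegral_radialDensity m hv x zero_le_one, hset,
    ← setLIntegral_indicator measurableSet_Iic]
  refine setLIntegral_mono' measurableSet_Ioi fun r hr => ?_
  by_cases h : r • x ∈ K
  · rw [ofReal_pow_mul_indicator_of_mem m v hr h, indicator_of_mem (mem_Iic.2 (hK r hr h))]
  · simp [h]

/-- The closed convex set of all `x` with `⟪x, y⟫ ≤ h y` for all unit vectors `y`. -/
def wulffShape (h : E → ℝ) : Set E := {x | ∀ y, ‖y‖ = 1 → ⟪x, y⟫ ≤ h y}

theorem isClosed_wulffShape (h : E → ℝ) : IsClosed (wulffShape h) := by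
  simp only [wulffShape, ofPred_forall]
  exact isClosed_iInter fun y => isClosed_iInter fun _ =>
    isClosed_le (by fun_prop) continuous_const

theorem norm_midpoint_le_one_of_mem_wulffShape {g : E → ℝ} {t : ℝ} {x y : E}
    (hx : x ∈ wulffShape fun z => 1 + t * g z) (hy : y ∈ wulffShape fun z => 1 + t * -g z) :
    ‖(2 : ℝ)⁻¹ • (x + y)‖ ≤ 1 := by
  set z := (2 : ℝ)⁻¹ • (x + y) with hz
  rcases eq_or_ne z 0 with h0 | h0
  · simp [h0]
  have hn : ‖z‖ ≠ 0 := norm_ne_zero_iff.2 h0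
  have hu : ‖‖z‖⁻¹ • z‖ = 1 := by simp [norm_smul, hn]
  have h1 := hx _ hu
  have h2 := hy _ hu
  have h3 : ⟪z, ‖z‖⁻¹ • z⟫ = ‖z‖ := by
    rw [real_inner_smul_right, real_inner_self_eq_norm_sq]
    field_simp
  have h4 : ⟪z, ‖z‖⁻¹ • z⟫ = 2⁻¹ * (⟪x, ‖z‖⁻¹ • z⟫ + ⟪y, ‖z‖⁻¹ • z⟫) := by
    conv_lhs => rw [hz, real_inner_smul_left, inner_add_left]
  linarith

theorem exp_neg_mul_exp_neg_le {v : E → ℝ} (hv : ConvexOn ℝ univ v) (x y : E) :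
    ENNReal.ofReal (Real.exp (-v x)) * ENNReal.ofReal (Real.exp (-v y)) ≤
      ENNReal.ofReal (Real.exp (-v ((2 : ℝ)⁻¹ • (x + y)))) ^ 2 := by
  rw [← ENNReal.ofReal_mul (by positivity), ← ENNReal.ofReal_pow (by positivity), ← Real.exp_add,
    ← Real.exp_nat_mul]
  refine ENNReal.ofReal_le_ofReal (Real.exp_le_exp.2 ?_)
  have := hv.2 (mem_univ x) (mem_univ y) (show (0 : ℝ) ≤ 2⁻¹ by norm_num)
    (show (0 : ℝ) ≤ 2⁻¹ by norm_num) (by norm_num)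
  rw [← smul_add, smul_eq_mul, smul_eq_mul] at this
  push_cast
  linarith

variable [FiniteDimensional ℝ E]

theorem mem_wulffShape_of_le_perturbedRadius {g : E → ℝ} {δ t : ℝ} {x : E}
    (h : ∀ y, ‖y‖ = 1 → perturbedRadius g δ t x * ⟪x, y⟫ ≤ 1 + t * g y)
    (hg : ∀ y, ‖y‖ = 1 → 0 ≤ 1 + t * g y) {r : ℝ} (hr : r ∈ Ioc 0 (perturbedRadius g δ t x)) :
    r • x ∈ wulffShape fun z => 1 + t * g z := by
  intro y hy
  rw [real_inner_smul_left]
  rcases le_total 0 ⟪x, y⟫ with hxy | hxy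
  · exact (mul_le_mul_of_nonneg_right hr.2 hxy).trans (h y hy)
  · exact (mul_nonpos_of_nonneg_of_nonpos hr.1.le hxy).trans (hg y hy)

variable [MeasurableSpace E] [BorelSpace E]

/-- The weighted volumes of the sets with support functions `1 + t * g` and `1 - t * g` are
controlled by that of the unit ball. -/
theorem PrekopaLeindler.wulffShape_mul_le (hE : PrekopaLeindler (volume : Measure E)) {v : E → ℝ}
    (hv : ConvexOn ℝ univ v) (hvc : Continuous v) (g : E → ℝ) (t : ℝ) :
    (∫⁻ x, (wulffShape fun z => 1 + t * g z).indicator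
        (fun y => ENNReal.ofReal (Real.exp (-v y))) x) *
      (∫⁻ x, (wulffShape fun z => 1 + t * -g z).indicator
        (fun y => ENNReal.ofReal (Real.exp (-v y))) x) ≤
    (∫⁻ x, (Metric.closedBall (0 : E) 1).indicator
        (fun y => ENNReal.ofReal (Real.exp (-v y))) x) ^ 2 := by
  have hw : Measurable fun y => ENNReal.ofReal (Real.exp (-v y)) := by fun_prop
  refine hE _ _ _ (hw.indicator (isClosed_wulffShape _).measurableSet)
    (hw.indicator (isClosed_wulffShape _).measurableSet) (hw.indicator measurableSet_closedBall)
    fun x y => ?_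
  by_cases hx : x ∈ wulffShape fun z => 1 + t * g z
  · by_cases hy : y ∈ wulffShape fun z => 1 + t * -g z
    · rw [indicator_of_mem hx, indicator_of_mem hy, indicator_of_mem
        (by simpa only [mem_closedBall_zero_iff] using
          norm_midpoint_le_one_of_mem_wulffShape hx hy)]
      exact exp_neg_mul_exp_neg_le hv x y
    · rw [indicator_of_notMem hy, mul_zero]
      exact zero_le
  · rw [indicator_of_notMem hx, zero_mul]
    exact zero_le

theorem Continuous.integrable_of_ae_norm_eq_one {σ : Measure E} [IsFiniteMeasure σ]
    (hσ : ∀ᵐ x ∂σ, ‖x‖ = 1) {f : E → ℝ} (hf : Continuous f) : Integrable f σ := by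
  obtain ⟨M, -, hM⟩ := exists_abs_le_of_norm_eq_one hf
  exact Integrable.of_bound hf.aestronglyMeasurable M (hσ.mono hM)

theorem eventually_le_lintegral_wulffShape {σ : Measure E} [IsProbabilityMeasure σ]
    (hσs : ∀ᵐ x ∂σ, ‖x‖ = 1) (m : ℕ) {v g : E → ℝ} (hv : ContDiff ℝ 1 v) (hg : ContDiff ℝ 1 g)
    (hmean : ∫ x, Real.exp (-v x) * g x ∂σ = 0) {δ : ℝ} (hδ : 0 < δ) :
    ∀ᶠ t in 𝓝[>] (0 : ℝ), ENNReal.ofReal ((∫ x, (∫ r in (0 : ℝ)..1, radialDensity m v x r) ∂σ) +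
      t ^ 2 * ((∫ x, Real.exp (-v x) * ((m - ⟪gradient v x, x⟫) * g x ^ 2 / 2 -
        (‖tangentialGradient g x‖ ^ 2 + δ) / 2) ∂σ) - δ)) ≤
      ∫⁻ x, (∫⁻ r in Ioi (0 : ℝ), ENNReal.ofReal (r ^ m) *
        (wulffShape fun z => 1 + t * g z).indicator
          (fun y => ENNReal.ofReal (Real.exp (-v y))) (r • x)) ∂σ := by
  have hT := continuous_tangentialGradient hg
  have hgc := hg.continuous
  have hvc := hv.continuous
  have hgrad := continuous_gradient hv
  obtain ⟨B, hB0, hB⟩ := exists_abs_le_of_norm_eq_one hgc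
  filter_upwards [self_mem_nhdsWithin, eventually_mul_le B one_pos,
    eventually_perturbedRadius_mul_inner_le hg hδ,
    eventually_le_integral_radialDensity m hv hgc
      (p := fun x => (‖tangentialGradient g x‖ ^ 2 + δ) / 2) (by fun_prop) hδ]
    with t ht0 htB hR hexp
  replace ht0 : 0 < t := ht0
  have hpos : ∀ y : E, ‖y‖ = 1 → 0 ≤ 1 + t * g y := fun y hy => by
    have := mul_le_mul_of_nonneg_left (abs_le.1 (hB y hy)).1 ht0.le
    linarith
  have hI0 : Integrable (fun x => ∫ r in (0 : ℝ)..1, radialDensity m v x r) σ :=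
    (intervalIntegral.continuous_parametric_intervalIntegral_of_continuous'
      (continuous_radialDensity m hvc) 0 1).integrable_of_ae_norm_eq_one hσs
  have hI1 : Integrable (fun x => Real.exp (-v x) * g x) σ :=
    Continuous.integrable_of_ae_norm_eq_one hσs (by fun_prop)
  have hI2 : Integrable (fun x => Real.exp (-v x) * ((m - ⟪gradient v x, x⟫) * g x ^ 2 / 2 -
      (‖tangentialGradient g x‖ ^ 2 + δ) / 2)) σ :=
    Continuous.integrable_of_ae_norm_eq_one hσs (by fun_prop)
  have hI3 : Integrable (fun x => Real.exp (-v x) * ((m - ⟪gradient v x, x⟫) * g x ^ 2 / 2 -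
      (‖tangentialGradient g x‖ ^ 2 + δ) / 2) - δ) σ := hI2.sub (integrable_const δ)
  have hI01 : Integrable (fun x => (∫ r in (0 : ℝ)..1, radialDensity m v x r) +
      t * (Real.exp (-v x) * g x)) σ := hI0.add (hI1.const_mul t)
  have hsum : (∫ x, (∫ r in (0 : ℝ)..1, radialDensity m v x r) ∂σ) +
      t ^ 2 * ((∫ x, Real.exp (-v x) * ((m - ⟪gradient v x, x⟫) * g x ^ 2 / 2 -
        (‖tangentialGradient g x‖ ^ 2 + δ) / 2) ∂σ) - δ) =
      ∫ x, ((∫ r in (0 : ℝ)..1, radialDensity m v x r) + t * (Real.exp (-v x) * g x) +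
        t ^ 2 * (Real.exp (-v x) * ((m - ⟪gradient v x, x⟫) * g x ^ 2 / 2 -
          (‖tangentialGradient g x‖ ^ 2 + δ) / 2) - δ)) ∂σ := by
    rw [integral_add hI01 (hI3.const_mul (t ^ 2)),
      integral_add hI0 (hI1.const_mul t), integral_const_mul, integral_const_mul, hmean,
      integral_sub hI2 (integrable_const δ)]
    simp
  rw [hsum]
  refine (ofReal_integral_le_lintegral_ofReal
    (hI01.add (hI3.const_mul (t ^ 2)))).trans (lintegral_mono_ae ?_)
  filter_upwards [hσs] with x hx
  refine (ENNReal.ofReal_le_ofReal (hexp x hx).2).trans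
    (ofReal_integral_radialDensity_le m hvc (hexp x hx).1 fun r hr => ?_)
  exact mem_wulffShape_of_le_perturbedRadius (fun y hy => hR x y hx hy) hpos hr

/-- The weighted spherical Poincaré inequality, written with respect to the rotation invariant
probability measure on the sphere. -/
theorem PrekopaLeindler.integral_sphere_nonpos [Nontrivial E]
    (hE : PrekopaLeindler (volume : Measure E)) {σ : Measure E} [IsProbabilityMeasure σ]
    (hσ : ∀ R : E ≃ₗᵢ[ℝ] E, σ.map R = σ) (hσs : ∀ᵐ x ∂σ, ‖x‖ = 1) {v g : E → ℝ}
    (hconv : ConvexOn ℝ univ v) (hv : ContDiff ℝ 1 v) (hg : ContDiff ℝ 1 g)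
    (hmean : ∫ x, Real.exp (-v x) * g x ∂σ = 0) {δ : ℝ} (hδ : 0 < δ) :
    ∫ x, Real.exp (-v x) * (((Module.finrank ℝ E - 1 : ℕ) - ⟪gradient v x, x⟫) * g x ^ 2 / 2 -
      (‖tangentialGradient g x‖ ^ 2 + δ) / 2) ∂σ ≤ δ := by
  obtain ⟨c, hc0, hct, hpolar⟩ := exists_lintegral_eq_mul_lintegral_sphere hσ hσs
  set m := Module.finrank ℝ E - 1
  have hvc := hv.continuous
  have hneg : tangentialGradient (fun x => -g x) = fun x => -tangentialGradient g x := by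
    funext x
    have : gradient (fun x => -g x) x = -gradient g x := by simp [gradient]
    simp [tangentialGradient, this]
    abel
  have hlow := eventually_le_lintegral_wulffShape hσs m hv hg hmean hδ
  have hlow' := eventually_le_lintegral_wulffShape hσs m hv hg.neg
    (by simpa [integral_neg] using hmean) hδ
  simp only [neg_sq, hneg, norm_neg] at hlow'
  have hpos : ∀ᶠ t in 𝓝[>] (0 : ℝ), 0 < t := self_mem_nhdsWithin
  obtain ⟨t, ht0, h1, h2⟩ := (hpos.and (hlow.and hlow')).exists
  set I := ∫ x, (∫ r in (0 : ℝ)..1, radialDensity m v x r) ∂σ with hI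
  set J := ∫ x, Real.exp (-v x) * ((m - ⟪gradient v x, x⟫) * g x ^ 2 / 2 -
      (‖tangentialGradient g x‖ ^ 2 + δ) / 2) ∂σ with hJ
  have hw : Measurable fun y => ENNReal.ofReal (Real.exp (-v y)) := by fun_prop
  have hball : ∫⁻ x, (∫⁻ r in Ioi (0 : ℝ), ENNReal.ofReal (r ^ m) *
      (Metric.closedBall (0 : E) 1).indicator
        (fun y => ENNReal.ofReal (Real.exp (-v y))) (r • x)) ∂σ ≤ ENNReal.ofReal I := by
    rw [hI, ofReal_integral_eq_lintegral_ofReal]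
    · refine lintegral_mono_ae ?_
      filter_upwards [hσs] with x hx
      refine le_ofReal_integral_radialDensity m hvc fun r hr hmem => ?_
      simpa [norm_smul, hx, abs_of_pos hr] using hmem
    · exact (intervalIntegral.continuous_parametric_intervalIntegral_of_continuous'
        (continuous_radialDensity m hvc) 0 1).integrable_of_ae_norm_eq_one hσs
    · exact ae_of_all _ fun x => intervalIntegral.integral_nonneg zero_le_one fun r hr =>
        radialDensity_nonneg m v x hr.1
  have hI0 : 0 ≤ I := integral_nonneg fun x => intervalIntegral.integral_nonneg zero_le_one
    fun r hr => radialDensity_nonneg m v x hr.1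
  have hPL := hE.wulffShape_mul_le hconv hvc g t
  rw [hpolar _ (hw.indicator (isClosed_wulffShape _).measurableSet),
    hpolar _ (hw.indicator (isClosed_wulffShape _).measurableSet),
    hpolar _ (hw.indicator measurableSet_closedBall), mul_mul_mul_comm, mul_pow, ← sq,
    ENNReal.mul_le_mul_iff_right (by simp [hc0]) (by simp [hct])] at hPL
  have hfin := ((mul_le_mul' h1 h2).trans hPL).trans (pow_le_pow_left' hball 2)
  by_contra! hlt
  have hgain : 0 < t ^ 2 * (J - δ) := by
    have : 0 < J - δ := by linarith
    positivity
  rw [← sq, ← ENNReal.ofReal_pow (by positivity), ← ENNReal.ofReal_pow hI0,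
    ENNReal.ofReal_le_ofReal_iff (by positivity)] at hfin
  nlinarith

end WeightedPoincare

theorem statement12 (n : ℕ) (hn : 2 ≤ n)
    (v : EuclideanSpace ℝ (Fin n) → ℝ)
    (hv_conv : ConvexOn ℝ Set.univ v) (hv_smooth : ContDiff ℝ 1 v)
    -- `σ` is the normalized rotation invariant (probability) measure on the unit sphere
    (σ : Measure (EuclideanSpace ℝ (Fin n))) [IsProbabilityMeasure σ]
    (hσ_sphere : σ (Metric.sphere (0 : EuclideanSpace ℝ (Fin n)) 1)ᶜ = 0)
    (hσ_inv : ∀ R : EuclideanSpace ℝ (Fin n) ≃ₗᵢ[ℝ] EuclideanSpace ℝ (Fin n),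
      σ.map R = σ)
    (μ : Measure (EuclideanSpace ℝ (Fin n)))
    (hμ : μ = σ.withDensity (fun x => ENNReal.ofReal (Real.exp (-v x))))
    (g : EuclideanSpace ℝ (Fin n) → ℝ) (hg : ContDiff ℝ 1 g)
    (hg_mean : ∫ x, g x ∂μ = 0) :
    ∫ x, ((n : ℝ) - 1 - ⟪gradient v x, x⟫) * g x ^ 2 ∂μ ≤
      ∫ x, ‖gradient g x - ⟪gradient g x, x⟫ • x‖ ^ 2 ∂μ := by
  have : Nonempty (Fin n) := ⟨⟨0, by omega⟩⟩
  have hσs : ∀ᵐ x ∂σ, ‖x‖ = 1 := by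
    rw [ae_iff]
    refine measure_mono_null (fun x hx => ?_) hσ_sphere
    simpa using hx
  have hvc := hv_smooth.continuous
  have hgc := hg.continuous
  have hgrad := continuous_gradient hv_smooth
  have hT := continuous_tangentialGradient hg
  have hwd (F : EuclideanSpace ℝ (Fin n) → ℝ) :
      ∫ x, F x ∂μ = ∫ x, Real.exp (-v x) * F x ∂σ := by
    rw [hμ, integral_withDensity_eq_integral_toReal_smul (by fun_prop) (by simp)]
    simp [ENNReal.toReal_ofReal, Real.exp_nonneg]
  have hcast : ((n - 1 : ℕ) : ℝ) = n - 1 := by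
    rw [Nat.cast_sub (by omega), Nat.cast_one]
  have key (δ : ℝ) (hδ : 0 < δ) := (prekopaLeindler_euclideanSpace n).integral_sphere_nonpos
    hσ_inv hσs hv_conv hv_smooth hg (by rw [← hwd]; exact hg_mean) hδ
  simp only [finrank_euclideanSpace_fin, hcast] at key
  have hI1 : Integrable (fun x => Real.exp (-v x) * (((n : ℝ) - 1 - ⟪gradient v x, x⟫) *
      g x ^ 2)) σ := Continuous.integrable_of_ae_norm_eq_one hσs (by fun_prop)
  have hI2 : Integrable (fun x => Real.exp (-v x) * ‖tangentialGradient g x‖ ^ 2) σ :=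
    Continuous.integrable_of_ae_norm_eq_one hσs (by fun_prop)
  have hI3 : Integrable (fun x => Real.exp (-v x)) σ :=
    Continuous.integrable_of_ae_norm_eq_one hσs (by fun_prop)
  have hI12 : Integrable (fun x => Real.exp (-v x) * (((n : ℝ) - 1 - ⟪gradient v x, x⟫) *
      g x ^ 2) - Real.exp (-v x) * ‖tangentialGradient g x‖ ^ 2) σ := hI1.sub hI2
  rw [hwd, hwd]
  change _ ≤ ∫ x, Real.exp (-v x) * ‖tangentialGradient g x‖ ^ 2 ∂σ
  set X := ∫ x, Real.exp (-v x) * (((n : ℝ) - 1 - ⟪gradient v x, x⟫) * g x ^ 2) ∂σ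
  set Y := ∫ x, Real.exp (-v x) * ‖tangentialGradient g x‖ ^ 2 ∂σ
  set W := ∫ x, Real.exp (-v x) ∂σ
  have hW : 0 ≤ W := integral_nonneg fun x => (Real.exp_pos _).le
  have hbound (δ : ℝ) (hδ : 0 < δ) : X ≤ Y + δ * (W + 2) := by
    have heq : ∫ x, Real.exp (-v x) * (((n : ℝ) - 1 - ⟪gradient v x, x⟫) * g x ^ 2 / 2 -
        (‖tangentialGradient g x‖ ^ 2 + δ) / 2) ∂σ = 1 / 2 * (X - Y - δ * W) := by
      rw [← integral_sub hI1 hI2, ← integral_const_mul δ, ← integral_sub hI12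
        (hI3.const_mul δ), ← integral_const_mul]
      exact integral_congr_ae (ae_of_all _ fun x => by ring)
    have := key δ hδ
    rw [heq] at this
    linarith
  refine le_of_forall_pos_le_add fun ε hε => ?_
  refine (hbound (ε / (W + 2)) (by positivity)).trans (le_of_eq ?_)
  rw [div_mul_cancel₀ _ (by positivity)]
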